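/- Let m : ℤ → ℂ be a bounded sequence satisfying sup_{N ∈ ℕ} ∑_{N ≤ |n| ≤ 2N} |m(n)|² < ∞. Then there exists a constant C > 0, depending only on m, such that for every integrable function f : 𝕋 → ℂ, ( ∑_{n ∈ ℤ} |m(n) f̂(n)|² )^{1/2} ≤ C · ( 1 + ∫_𝕋 |f(θ)| log^{1/2}(1 + |f(θ)|) dθ ). -/

import Mathlib

open MeasureTheory ENNReal NNReal

/-- Trigonometric polynomials on `ℝ/ℤ` with frequencies in `s`. -/
noncomputable def trigSpan (s : Set ℤ) : Submodule ℂ C(AddCircle (1 : ℝ), ℂ) :=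
  Submodule.span ℂ ((fun n : ℤ => fourier n) '' s)

lemma fourier_mem_trigSpan {s : Set ℤ} {n : ℤ} (hn : n ∈ s) : fourier n ∈ trigSpan s :=
  Submodule.subset_span ⟨n, hn, rfl⟩

lemma trigSpan_mono {s t : Set ℤ} (h : s ⊆ t) : trigSpan s ≤ trigSpan t :=
  Submodule.span_mono (Set.image_mono h)

lemma mul_mem_trigSpan {s t u : Set ℤ} {p q : C(AddCircle (1 : ℝ), ℂ)} (hp : p ∈ trigSpan s)
    (hq : q ∈ trigSpan t) (h : ∀ a ∈ s, ∀ b ∈ t, a + b ∈ u) : p * q ∈ trigSpan u := by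
  have hpq := Submodule.mul_mem_mul hp hq
  rw [trigSpan, trigSpan, Submodule.span_mul_span] at hpq
  refine Submodule.span_mono ?_ hpq
  rintro _ ⟨_, ⟨a, ha, rfl⟩, _, ⟨b, hb, rfl⟩, rfl⟩
  refine ⟨a + b, h a ha b hb, ?_⟩
  ext x
  simp

lemma integrable_continuousMap {E : Type*} [NormedAddCommGroup E] (p : C(AddCircle (1 : ℝ), E)) :
    Integrable p AddCircle.haarAddCircle :=
  p.continuous.integrable_of_hasCompactSupport (HasCompactSupport.of_compactSpace p)

lemma integral_eq_zero_of_mem_trigSpan {s : Set ℤ} (hs : (0 : ℤ) ∉ s)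
    {p : C(AddCircle (1 : ℝ), ℂ)} (hp : p ∈ trigSpan s) :
    ∫ x, p x ∂AddCircle.haarAddCircle = 0 := by
  induction hp using Submodule.span_induction with
  | mem p hp =>
    obtain ⟨n, hn, rfl⟩ := hp
    have hn0 : n ≠ 0 := fun h => hs (h ▸ hn)
    have h := congrFun (fourierCoeff_fourier (T := (1 : ℝ)) n) 0
    simpa [fourierCoeff, Pi.single_apply, hn0.symm, hn0] using h
  | zero => simp
  | add p q _ _ hp hq =>
    simp only [ContinuousMap.add_apply]
    rw [integral_add (integrable_continuousMap p) (integrable_continuousMap q), hp, hq, add_zero]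
  | smul c p _ hp =>
    simp only [ContinuousMap.smul_apply]
    rw [integral_smul, hp, smul_zero]

/-- Riesz products over separated dyadic blocks integrate to the product of their constant
terms. -/
lemma integral_riesz_product (r : ℕ) (w : ℕ → C(AddCircle (1 : ℝ), ℂ)) (c d : ℕ → ℂ)
    (hw : ∀ k, w k ∈ trigSpan {n | 2 ^ (r + 2 * k) ≤ |n| ∧ |n| < 2 ^ (r + 2 * k + 1)}) (K : ℕ) :
    ∏ k ∈ Finset.range K, (c k • 1 + d k • w k) ∈ trigSpan {n | |n| < 2 ^ (r + 2 * K)} ∧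
      ∫ x, (∏ k ∈ Finset.range K, (c k • 1 + d k • w k)) x ∂AddCircle.haarAddCircle =
        ∏ k ∈ Finset.range K, c k := by
  induction K with
  | zero =>
    have h1 : (1 : C(AddCircle (1 : ℝ), ℂ)) = fourier 0 := by ext x; simp
    refine ⟨?_, by simp⟩
    rw [Finset.range_zero, Finset.prod_empty, h1]
    exact fourier_mem_trigSpan (by simp)
  | succ K ih =>
    obtain ⟨hP, hI⟩ := ih
    rw [Finset.prod_range_succ, Finset.prod_range_succ]
    set P := ∏ k ∈ Finset.range K, (c k • 1 + d k • w k)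
    have hexp : P * (c K • 1 + d K • w K) = c K • P + d K • (P * w K) := by
      rw [mul_add, mul_smul_comm, mul_smul_comm, mul_one]
    have hpow : (2 : ℤ) ^ (r + 2 * (K + 1)) = 4 * 2 ^ (r + 2 * K) := by ring
    have hpow' : (2 : ℤ) ^ (r + 2 * K + 1) = 2 * 2 ^ (r + 2 * K) := by ring
    have hpos : (0 : ℤ) < 2 ^ (r + 2 * K) := by positivity
    have hPw : P * w K ∈ trigSpan {n | n ≠ 0 ∧ |n| < 2 ^ (r + 2 * (K + 1))} := by
      refine mul_mem_trigSpan hP (hw K) fun a ha b hb => ?_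
      simp only [Set.mem_ofPred_eq] at ha hb ⊢
      rw [hpow'] at hb
      rw [hpow]
      have hab := abs_add_le a b
      refine ⟨fun h => ?_, by linarith⟩
      rw [eq_neg_of_add_eq_zero_left h, abs_neg] at ha
      linarith
    rw [hexp]
    refine ⟨Submodule.add_mem _ (Submodule.smul_mem _ _ (trigSpan_mono ?_ hP))
      (Submodule.smul_mem _ _ (trigSpan_mono (fun n hn => hn.2) hPw)), ?_⟩
    · intro n hn
      simp only [Set.mem_ofPred_eq] at hn ⊢
      omega
    · have h0 := integral_eq_zero_of_mem_trigSpan (by simp) hPw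
      simp only [ContinuousMap.add_apply]
      rw [integral_add (integrable_continuousMap (c K • P))
        (integrable_continuousMap (d K • (P * w K)))]
      simp only [ContinuousMap.smul_apply]
      rw [integral_smul, integral_smul, hI, h0]
      simp [mul_comm]

/-- Sub-Gaussian exponential moments for sums of bounded real trigonometric polynomials supported
in separated dyadic blocks. -/
lemma integral_exp_sum_le (r : ℕ) (w : ℕ → C(AddCircle (1 : ℝ), ℂ))
    (v : ℕ → C(AddCircle (1 : ℝ), ℝ)) (hwv : ∀ k x, w k x = (v k x : ℂ)) (b : ℕ → ℝ)
    (hb : ∀ k x, |v k x| ≤ b k)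
    (hw : ∀ k, w k ∈ trigSpan {n | 2 ^ (r + 2 * k) ≤ |n| ∧ |n| < 2 ^ (r + 2 * k + 1)})
    (K : ℕ) (t : ℝ) :
    ∫ x, Real.exp (t * ∑ k ∈ Finset.range K, v k x) ∂AddCircle.haarAddCircle ≤
      Real.exp (t ^ 2 * (∑ k ∈ Finset.range K, b k ^ 2) / 2) := by
  have hpt (k : ℕ) (x : AddCircle (1 : ℝ)) :
      Real.exp (t * v k x) ≤ Real.cosh (t * b k) + Real.sinh (t * b k) / b k * v k x := by
    rcases eq_or_ne (b k) 0 with h0 | h0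
    · have hv : v k x = 0 := by simpa [h0] using hb k x
      simp [hv, h0]
    · have hpos : 0 < b k := lt_of_le_of_ne ((abs_nonneg _).trans (hb k x)) h0.symm
      have hle : |v k x / b k| ≤ 1 := by
        rw [abs_div, abs_of_pos hpos, div_le_one hpos]
        exact hb k x
      have h := Real.exp_mul_le_cosh_add_mul_sinh hle (t * b k)
      rw [show v k x / b k * (t * b k) = t * v k x by field_simp] at h
      exact h.trans_eq (by ring)
  have hexp_int := (integral_riesz_product r w (fun k => (Real.cosh (t * b k) : ℂ))
    (fun k => ((Real.sinh (t * b k) / b k : ℝ) : ℂ)) hw K).2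
  have hreal : ∫ x, ∏ k ∈ Finset.range K,
      (Real.cosh (t * b k) + Real.sinh (t * b k) / b k * v k x) ∂AddCircle.haarAddCircle =
        ∏ k ∈ Finset.range K, Real.cosh (t * b k) := by
    rw [← Complex.ofReal_inj, ← integral_complex_ofReal, Complex.ofReal_prod]
    simp only [Complex.ofReal_prod]
    rw [← hexp_int]
    refine integral_congr_ae (Filter.Eventually.of_forall fun x => ?_)
    simp [ContinuousMap.prod_apply, hwv]
  calc ∫ x, Real.exp (t * ∑ k ∈ Finset.range K, v k x) ∂AddCircle.haarAddCircle
      ≤ ∫ x, ∏ k ∈ Finset.range K,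
          (Real.cosh (t * b k) + Real.sinh (t * b k) / b k * v k x)
            ∂AddCircle.haarAddCircle := by
        have hc : Continuous fun x => ∏ k ∈ Finset.range K,
            (Real.cosh (t * b k) + Real.sinh (t * b k) / b k * v k x) :=
          continuous_finsetProd _ fun k _ => by fun_prop
        have hc' : Continuous fun x => Real.exp (t * ∑ k ∈ Finset.range K, v k x) := by fun_prop
        refine integral_mono (integrable_continuousMap ⟨_, hc'⟩)
          (integrable_continuousMap ⟨_, hc⟩) fun x => ?_
        simp only [Finset.mul_sum, Real.exp_sum]
        exact Finset.prod_le_prod (fun _ _ => (Real.exp_pos _).le) fun k _ => hpt k x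
    _ = ∏ k ∈ Finset.range K, Real.cosh (t * b k) := hreal
    _ ≤ ∏ k ∈ Finset.range K, Real.exp ((t * b k) ^ 2 / 2) :=
        Finset.prod_le_prod (fun _ _ => (Real.cosh_pos _).le) fun k _ =>
          Real.cosh_le_exp_half_sq _
    _ = Real.exp (t ^ 2 * (∑ k ∈ Finset.range K, b k ^ 2) / 2) := by
        rw [← Real.exp_sum, Finset.mul_sum, Finset.sum_div]
        simp only [mul_pow]

/-- Sub-Gaussian exponential moments for Paley multipliers restricted to every other dyadic
block. -/
lemma integral_exp_paley_le (m : ℤ → ℂ) (A : ℝ)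
    (hA : ∀ N : ℕ, 1 ≤ N →
      ∑ n ∈ (Finset.Icc (-(2 * (N : ℤ))) (2 * (N : ℤ))).filter (fun n => (N : ℤ) ≤ |n|),
        ‖m n‖ ^ 2 ≤ A)
    (r : ℕ) (S : Finset ℤ) (hS : ∀ n ∈ S, n ≠ 0 ∧ Nat.log 2 n.natAbs % 2 = r)
    (a : ℤ → ℂ) (ha : ∑ n ∈ S, ‖a n‖ ^ 2 ≤ 1) (t : ℝ) :
    ∫ x : AddCircle (1 : ℝ), Real.exp (t * (∑ n ∈ S, m n * a n * fourier (-n) x).re)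
      ∂AddCircle.haarAddCircle ≤ Real.exp (t ^ 2 * A / 2) := by
  have hA0 : 0 ≤ A := (Finset.sum_nonneg fun _ _ => by positivity).trans (hA 1 le_rfl)
  set e : ℤ → ℕ := fun n => Nat.log 2 n.natAbs / 2 with he
  set B : ℕ → Finset ℤ := fun k => S.filter (fun n => e n = k) with hB
  have hblock (k : ℕ) (n : ℤ) (hn : n ∈ B k) :
      2 ^ (r + 2 * k) ≤ |n| ∧ |n| < 2 ^ (r + 2 * k + 1) := by
    simp only [hB, he, Finset.mem_filter] at hn
    obtain ⟨hn0, hr⟩ := hS n hn.1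
    have hlog : Nat.log 2 n.natAbs = r + 2 * k := by omega
    have h1 := Nat.pow_log_le_self 2 (Int.natAbs_ne_zero.mpr hn0)
    have h2 := Nat.lt_pow_succ_log_self (b := 2) one_lt_two n.natAbs
    rw [hlog] at h1 h2
    rw [Int.abs_eq_natAbs]
    exact ⟨by exact_mod_cast h1, by exact_mod_cast h2⟩
  have hmA (k : ℕ) : ∑ n ∈ B k, ‖m n‖ ^ 2 ≤ A := by
    refine (Finset.sum_le_sum_of_subset_of_nonneg (fun n hn => ?_)
      fun _ _ _ => by positivity).trans (hA (2 ^ (r + 2 * k)) Nat.one_le_two_pow)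
    obtain ⟨h1, h2⟩ := hblock k n hn
    rw [pow_succ] at h2
    have h3 := abs_le.mp h2.le
    simp only [Finset.mem_filter, Finset.mem_Icc]
    push_cast
    exact ⟨⟨by linarith, by linarith⟩, h1⟩
  let w : ℕ → C(AddCircle (1 : ℝ), ℂ) := fun k => ∑ n ∈ B k,
    ((m n * a n / 2) • fourier (-n) + (starRingEnd ℂ (m n * a n) / 2) • fourier n)
  let v : ℕ → C(AddCircle (1 : ℝ), ℝ) := fun k =>
    ⟨fun x => (∑ n ∈ B k, m n * a n * fourier (-n) x).re, by fun_prop⟩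
  have hwv (k : ℕ) (x : AddCircle (1 : ℝ)) : w k x = (v k x : ℂ) := by
    simp only [w, v, ContinuousMap.coe_mk, Complex.re_sum, Complex.ofReal_sum,
      ContinuousMap.sum_apply]
    refine Finset.sum_congr rfl fun n _ => ?_
    rw [Complex.re_eq_add_conj, map_mul (starRingEnd ℂ) (m n * a n), ← fourier_neg]
    simp only [ContinuousMap.add_apply, ContinuousMap.smul_apply, smul_eq_mul, neg_neg]
    ring
  have hb (k : ℕ) (x : AddCircle (1 : ℝ)) : |v k x| ≤ √A * √(∑ n ∈ B k, ‖a n‖ ^ 2) := by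
    calc |v k x| ≤ ‖∑ n ∈ B k, m n * a n * fourier (-n) x‖ := Complex.abs_re_le_norm _
      _ ≤ ∑ n ∈ B k, ‖m n‖ * ‖a n‖ := by
          refine (norm_sum_le _ _).trans (Finset.sum_le_sum fun n _ => ?_)
          rw [norm_mul, norm_mul, fourier_apply, Circle.norm_coe, mul_one]
      _ ≤ √(∑ n ∈ B k, ‖m n‖ ^ 2) * √(∑ n ∈ B k, ‖a n‖ ^ 2) :=
          Real.sum_mul_le_sqrt_mul_sqrt _ _ _
      _ ≤ _ := by gcongr; exact hmA k
  have hw (k : ℕ) :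
      w k ∈ trigSpan {n | 2 ^ (r + 2 * k) ≤ |n| ∧ |n| < 2 ^ (r + 2 * k + 1)} := by
    refine Submodule.sum_mem _ fun n hn => Submodule.add_mem _
      (Submodule.smul_mem _ _ (fourier_mem_trigSpan ?_))
      (Submodule.smul_mem _ _ (fourier_mem_trigSpan ?_))
    · simpa only [Set.mem_ofPred_eq, abs_neg] using hblock k n hn
    · exact hblock k n hn
  set K := S.sup e + 1
  have hmaps : ∀ n ∈ S, e n ∈ Finset.range K := fun n hn =>
    Finset.mem_range.mpr (Nat.lt_succ_of_le (Finset.le_sup hn))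
  have hsum (x : AddCircle (1 : ℝ)) :
      (∑ n ∈ S, m n * a n * fourier (-n) x).re = ∑ k ∈ Finset.range K, v k x := by
    rw [← Finset.sum_fiberwise_of_maps_to hmaps, Complex.re_sum]
    rfl
  have hsq : ∑ k ∈ Finset.range K, (√A * √(∑ n ∈ B k, ‖a n‖ ^ 2)) ^ 2 ≤ A := by
    have hk (k : ℕ) : (√A * √(∑ n ∈ B k, ‖a n‖ ^ 2)) ^ 2 = A * ∑ n ∈ B k, ‖a n‖ ^ 2 := by
      rw [mul_pow, Real.sq_sqrt hA0, Real.sq_sqrt (Finset.sum_nonneg fun _ _ => by positivity)]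
    simp only [hk]
    rw [← Finset.mul_sum, Finset.sum_fiberwise_of_maps_to hmaps]
    nlinarith
  simp only [hsum]
  refine (integral_exp_sum_le r w v hwv _ hb hw K t).trans (Real.exp_le_exp.mpr ?_)
  gcongr

/-- Sub-Gaussian exponential moments imply exponential square integrability. -/
lemma lintegral_exp_sq_le (A : ℝ) (s : ℝ) (hs : s = A / 2 + 1) (hs0 : 0 < s)
    (u : C(AddCircle (1 : ℝ), ℝ))
    (hu : ∀ t : ℝ, ∫ x, Real.exp (t * u x) ∂AddCircle.haarAddCircle ≤ Real.exp (t ^ 2 * A / 2)) :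
    ∫⁻ x, ENNReal.ofReal (Real.exp (u x ^ 2 / (4 * s))) ∂AddCircle.haarAddCircle ≤
      ENNReal.ofReal (Real.exp (s / 4)) * ∑' k : ℕ, ENNReal.ofReal (2 * Real.exp (-k)) := by
  have hpt (x : AddCircle (1 : ℝ)) : ENNReal.ofReal (Real.exp (u x ^ 2 / (4 * s))) ≤
      ENNReal.ofReal (Real.exp (s / 4)) *
        ∑' k : ℕ, ENNReal.ofReal (Real.exp (k * |u x| - s * k ^ 2)) := by
    set z := |u x| / (2 * s) with hz
    have hzu : |u x| = 2 * s * z := by rw [hz]; field_simp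
    have hz0 : 0 ≤ z := by positivity
    set k := ⌊z + 1 / 2⌋₊
    have h1 : (k : ℝ) ≤ z + 1 / 2 := Nat.floor_le (by positivity)
    have h2 : z + 1 / 2 < k + 1 := Nat.lt_floor_add_one _
    have hle : u x ^ 2 / (4 * s) ≤ s / 4 + (k * |u x| - s * k ^ 2) := by
      rw [← sq_abs (u x), hzu, show (2 * s * z) ^ 2 / (4 * s) = s * z ^ 2 by field_simp; ring]
      nlinarith [mul_nonneg hs0.le (mul_nonneg (by linarith : 0 ≤ z + 1 / 2 - k)
        (by linarith : 0 ≤ k + 1 / 2 - z))]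
    calc _ ≤ ENNReal.ofReal (Real.exp (s / 4) * Real.exp (k * |u x| - s * k ^ 2)) := by
          rw [← Real.exp_add]
          exact ENNReal.ofReal_le_ofReal (Real.exp_le_exp.mpr hle)
      _ ≤ _ := by
          rw [ENNReal.ofReal_mul (Real.exp_pos _).le]
          gcongr
          exact ENNReal.le_tsum (f := fun k : ℕ =>
            ENNReal.ofReal (Real.exp (k * |u x| - s * k ^ 2))) k
  refine (lintegral_mono hpt).trans ?_
  rw [lintegral_const_mul' _ _ ENNReal.ofReal_ne_top, lintegral_tsum fun k => by fun_prop]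
  gcongr with k
  have hexp_int (t : ℝ) : Integrable (fun x => Real.exp (t * u x)) AddCircle.haarAddCircle :=
    integrable_continuousMap ⟨_, by fun_prop⟩
  have hsum_int : Integrable (fun x => Real.exp (-(s * k ^ 2)) *
      (Real.exp (k * u x) + Real.exp (-k * u x))) AddCircle.haarAddCircle :=
    ((hexp_int k).add (hexp_int (-k))).const_mul _
  calc ∫⁻ x, ENNReal.ofReal (Real.exp (k * |u x| - s * k ^ 2)) ∂AddCircle.haarAddCircle
      ≤ ∫⁻ x, ENNReal.ofReal (Real.exp (-(s * k ^ 2)) *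
          (Real.exp (k * u x) + Real.exp (-k * u x))) ∂AddCircle.haarAddCircle := by
        refine lintegral_mono fun x => ENNReal.ofReal_le_ofReal ?_
        rw [sub_eq_neg_add, Real.exp_add]
        gcongr
        rcases abs_choice (u x) with h | h <;> rw [h]
        · exact le_add_of_nonneg_right (Real.exp_pos _).le
        · rw [mul_neg, ← neg_mul]
          exact le_add_of_nonneg_left (Real.exp_pos _).le
    _ = ENNReal.ofReal (Real.exp (-(s * k ^ 2)) *
          (∫ x, Real.exp (k * u x) ∂AddCircle.haarAddCircle +
            ∫ x, Real.exp (-k * u x) ∂AddCircle.haarAddCircle)) := by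
        rw [← integral_add (hexp_int _) (hexp_int _), ← integral_const_mul,
          ofReal_integral_eq_lintegral_ofReal hsum_int
            (Filter.Eventually.of_forall fun x => by positivity)]
    _ ≤ _ := by
        refine ENNReal.ofReal_le_ofReal ?_
        calc _ ≤ Real.exp (-(s * k ^ 2)) *
              (Real.exp (k ^ 2 * A / 2) + Real.exp ((-k) ^ 2 * A / 2)) := by
              gcongr <;> exact hu _
          _ = 2 * Real.exp (-(k : ℝ) ^ 2) := by
              rw [neg_sq, ← two_mul, mul_left_comm, ← Real.exp_add, hs]
              ring_nf
          _ ≤ _ := by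
              gcongr
              exact_mod_cast Nat.le_self_pow two_ne_zero k

/-- Young's inequality for the pair `x log^{1/2}(1+x)` and `exp (c y²)`. -/
lemma mul_le_mul_sqrt_log_add_exp_sq {s x y : ℝ} (hs : 0 < s) (hx : 0 ≤ x) (hy : 0 ≤ y) :
    x * y ≤ √(8 * s) *
      (x * Real.log (1 + x) ^ ((1 : ℝ) / 2) + Real.exp (y ^ 2 / (4 * s))) := by
  rw [← Real.sqrt_eq_rpow]
  have hlog : 0 ≤ Real.log (1 + x) := Real.log_nonneg (by linarith)
  rcases le_or_gt (y ^ 2) (8 * s * Real.log (1 + x)) with h | h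
  · have hle : y ≤ √(8 * s) * √(Real.log (1 + x)) := by
      rw [← Real.sqrt_mul (by positivity)]
      exact Real.le_sqrt_of_sq_le h
    calc x * y ≤ x * (√(8 * s) * √(Real.log (1 + x))) := by gcongr
      _ = √(8 * s) * (x * √(Real.log (1 + x))) := by ring
      _ ≤ _ := by
        gcongr
        exact le_add_of_nonneg_right (Real.exp_pos _).le
  · have hx' : x ≤ Real.exp (y ^ 2 / (8 * s)) := by
      have h1 : Real.log (1 + x) ≤ y ^ 2 / (8 * s) := by
        rw [le_div_iff₀ (by positivity)]
        linarith
      linarith [(Real.log_le_iff_le_exp (by linarith)).mp h1]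
    have hy' : y ≤ √(8 * s) * Real.exp (y ^ 2 / (8 * s)) := by
      have h1 := Real.add_one_le_exp (y ^ 2 / (8 * s))
      have h2 : y = √(8 * s) * (y / √(8 * s)) := by field_simp
      have h3 : (y / √(8 * s)) ^ 2 = y ^ 2 / (8 * s) := by
        rw [div_pow, Real.sq_sqrt (by positivity)]
      nth_rewrite 1 [h2]
      gcongr
      nlinarith [sq_nonneg (y / √(8 * s) - 1)]
    calc x * y ≤ Real.exp (y ^ 2 / (8 * s)) * (√(8 * s) * Real.exp (y ^ 2 / (8 * s))) := by
          gcongr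
      _ = √(8 * s) * Real.exp (y ^ 2 / (4 * s)) := by
          rw [mul_left_comm, ← Real.exp_add]
          congr 2
          field_simp
          ring
      _ ≤ _ := by
          gcongr
          exact le_add_of_nonneg_left (by positivity)

/-- Duality between `L log^{1/2} L` and functions with sub-Gaussian exponential moments. -/
lemma exists_lintegral_mul_le (A : ℝ) (hA : 0 ≤ A) :
    ∃ K : ℝ, 0 ≤ K ∧ ∀ u : C(AddCircle (1 : ℝ), ℝ),
      (∀ t : ℝ, ∫ x, Real.exp (t * u x) ∂AddCircle.haarAddCircle ≤ Real.exp (t ^ 2 * A / 2)) →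
      ∀ f : AddCircle (1 : ℝ) → ℂ,
        ∫⁻ x, ENNReal.ofReal (‖f x‖ * |u x|) ∂AddCircle.haarAddCircle ≤
          ENNReal.ofReal K * (1 + ∫⁻ x, (‖f x‖₊ : ℝ≥0∞) *
            ENNReal.ofReal (Real.log (1 + ‖f x‖) ^ ((1 : ℝ) / 2)) ∂AddCircle.haarAddCircle) := by
  obtain ⟨s, hs⟩ : ∃ s, s = A / 2 + 1 := ⟨_, rfl⟩
  have hs0 : 0 < s := by linarith
  set D := ENNReal.ofReal (Real.exp (s / 4)) * ∑' k : ℕ, ENNReal.ofReal (2 * Real.exp (-k))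
  have hDtop : D ≠ ⊤ := by
    refine ENNReal.mul_ne_top ENNReal.ofReal_ne_top ?_
    have hsum : Summable fun k : ℕ => 2 * Real.exp (-k) := Real.summable_exp_neg_nat.mul_left 2
    rw [← ENNReal.ofReal_tsum_of_nonneg (fun k => by positivity) hsum]
    exact ENNReal.ofReal_ne_top
  refine ⟨√(8 * s) * (1 + D.toReal), by positivity, fun u hu f => ?_⟩
  have hE := lintegral_exp_sq_le A s hs hs0 u hu
  set I := ∫⁻ x, (‖f x‖₊ : ℝ≥0∞) *
    ENNReal.ofReal (Real.log (1 + ‖f x‖) ^ ((1 : ℝ) / 2)) ∂AddCircle.haarAddCircle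
  calc ∫⁻ x, ENNReal.ofReal (‖f x‖ * |u x|) ∂AddCircle.haarAddCircle
      ≤ ∫⁻ x, ENNReal.ofReal (√(8 * s)) * ((‖f x‖₊ : ℝ≥0∞) *
          ENNReal.ofReal (Real.log (1 + ‖f x‖) ^ ((1 : ℝ) / 2)) +
            ENNReal.ofReal (Real.exp (u x ^ 2 / (4 * s)))) ∂AddCircle.haarAddCircle := by
        refine lintegral_mono fun x => ?_
        have h := ENNReal.ofReal_le_ofReal
          (mul_le_mul_sqrt_log_add_exp_sq hs0 (norm_nonneg (f x)) (abs_nonneg (u x)))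
        have hlog : 0 ≤ Real.log (1 + ‖f x‖) := Real.log_nonneg (by linarith [norm_nonneg (f x)])
        rw [ENNReal.ofReal_mul (p := √(8 * s)) (by positivity),
          ENNReal.ofReal_add (by positivity) (by positivity),
          ENNReal.ofReal_mul (p := ‖f x‖) (q := _ ^ _) (norm_nonneg _), sq_abs] at h
        rwa [ofReal_norm] at h
    _ = ENNReal.ofReal (√(8 * s)) * (I +
          ∫⁻ x, ENNReal.ofReal (Real.exp (u x ^ 2 / (4 * s))) ∂AddCircle.haarAddCircle) := by
        rw [lintegral_const_mul' _ _ ENNReal.ofReal_ne_top,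
          lintegral_add_right _ (by fun_prop)]
    _ ≤ ENNReal.ofReal (√(8 * s)) * (I + D) := by gcongr
    _ ≤ ENNReal.ofReal (√(8 * s)) * ((1 + D) * (1 + I)) := by
        gcongr
        calc I + D ≤ I + D + (1 + D * I) := le_self_add
          _ = (1 + D) * (1 + I) := by ring
    _ = _ := by
        rw [ENNReal.ofReal_mul (by positivity), ENNReal.ofReal_add zero_le_one (by positivity),
          ENNReal.ofReal_toReal hDtop, ENNReal.ofReal_one, mul_assoc]

/-- The square function bound for the multiplier restricted to every other dyadic block. -/
lemma exists_sqrt_sum_le (m : ℤ → ℂ) (A : ℝ)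
    (hA : ∀ N : ℕ, 1 ≤ N →
      ∑ n ∈ (Finset.Icc (-(2 * (N : ℤ))) (2 * (N : ℤ))).filter (fun n => (N : ℤ) ≤ |n|),
        ‖m n‖ ^ 2 ≤ A) :
    ∃ K : ℝ, 0 ≤ K ∧ ∀ (r : ℕ) (S : Finset ℤ),
      (∀ n ∈ S, n ≠ 0 ∧ Nat.log 2 n.natAbs % 2 = r) →
      ∀ f : AddCircle (1 : ℝ) → ℂ, Integrable f AddCircle.haarAddCircle →
        ENNReal.ofReal √(∑ n ∈ S, ‖m n * fourierCoeff f n‖ ^ 2) ≤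
          ENNReal.ofReal K * (1 + ∫⁻ x, (‖f x‖₊ : ℝ≥0∞) *
            ENNReal.ofReal (Real.log (1 + ‖f x‖) ^ ((1 : ℝ) / 2)) ∂AddCircle.haarAddCircle) := by
  have hA0 : 0 ≤ A := (Finset.sum_nonneg fun _ _ => by positivity).trans (hA 1 le_rfl)
  obtain ⟨K, hK0, hK⟩ := exists_lintegral_mul_le A hA0
  refine ⟨2 * K, by positivity, fun r S hS f hf => ?_⟩
  set J := 1 + ∫⁻ x, (‖f x‖₊ : ℝ≥0∞) *
    ENNReal.ofReal (Real.log (1 + ‖f x‖) ^ ((1 : ℝ) / 2)) ∂AddCircle.haarAddCircle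
  set T := √(∑ n ∈ S, ‖m n * fourierCoeff f n‖ ^ 2) with hT
  have hTsq : T ^ 2 = ∑ n ∈ S, ‖m n * fourierCoeff f n‖ ^ 2 :=
    Real.sq_sqrt (Finset.sum_nonneg fun _ _ => by positivity)
  rcases (Real.sqrt_nonneg _ : 0 ≤ T).eq_or_lt with h0 | hTpos
  · rw [hT, ← h0, ENNReal.ofReal_zero]
    exact zero_le
  have hTC : (T : ℂ) ≠ 0 := by exact_mod_cast hTpos.ne'
  set a : ℤ → ℂ := fun n => starRingEnd ℂ (m n * fourierCoeff f n) / T with ha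
  have ha1 : ∑ n ∈ S, ‖a n‖ ^ 2 ≤ 1 := by
    simp only [ha, norm_div, RCLike.norm_conj, div_pow]
    rw [← Finset.sum_div, ← hTsq, Complex.norm_real, Real.norm_eq_abs, sq_abs,
      div_self (by positivity)]
  have hbound (b : ℤ → ℂ) (hb : ∑ n ∈ S, ‖b n‖ ^ 2 ≤ 1) :
      ∫⁻ x, ENNReal.ofReal (‖f x‖ * |(∑ n ∈ S, m n * b n * fourier (-n) x).re|)
        ∂AddCircle.haarAddCircle ≤ ENNReal.ofReal K * J :=
    hK ⟨fun x => (∑ n ∈ S, m n * b n * fourier (-n) x).re, by fun_prop⟩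
      (integral_exp_paley_le m A hA r S hS b hb) f
  have hre := hbound a ha1
  have him := hbound (fun n => -Complex.I * a n) (by simpa using ha1)
  have hIm (x : AddCircle (1 : ℝ)) :
      (∑ n ∈ S, m n * (-Complex.I * a n) * fourier (-n) x).re =
        (∑ n ∈ S, m n * a n * fourier (-n) x).im := by
    have h : ∑ n ∈ S, m n * (-Complex.I * a n) * fourier (-n) x =
        -Complex.I * ∑ n ∈ S, m n * a n * fourier (-n) x := by
      rw [Finset.mul_sum]
      exact Finset.sum_congr rfl fun n _ => by ring
    rw [h]
    simp
  simp only [hIm] at him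
  set g : AddCircle (1 : ℝ) → ℂ := fun x => ∑ n ∈ S, m n * a n * fourier (-n) x with hg
  have hdual : (T : ℂ) = ∫ x, g x * f x ∂AddCircle.haarAddCircle := by
    have hexp_int (n : ℤ) : Integrable (fun x => m n * a n * (fourier (-n) x * f x))
        AddCircle.haarAddCircle := by
      refine (hf.bdd_mul (c := 1) (f := fun x => fourier (-n) x)
        (by fun_prop) (Filter.Eventually.of_forall fun x => ?_)).const_mul _
      rw [fourier_apply, Circle.norm_coe]
    simp only [hg, Finset.sum_mul, mul_assoc (m _ * a _)]
    rw [integral_finsetSum _ fun n _ => hexp_int n]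
    simp only [integral_const_mul]
    have hn (n : ℤ) : m n * a n * ∫ x, fourier (-n) x * f x ∂AddCircle.haarAddCircle =
        (‖m n * fourierCoeff f n‖ ^ 2 : ℝ) / T := by
      rw [Complex.ofReal_pow, ← Complex.mul_conj']
      simp only [ha, fourierCoeff, smul_eq_mul]
      ring
    simp only [hn]
    rw [← Finset.sum_div, ← Complex.ofReal_sum, ← hTsq, Complex.ofReal_pow, sq,
      mul_div_cancel_right₀ _ hTC]
  calc ENNReal.ofReal T = ‖∫ x, g x * f x ∂AddCircle.haarAddCircle‖ₑ := by
        rw [← hdual, ← ofReal_norm, Complex.norm_real, Real.norm_of_nonneg hTpos.le]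
    _ ≤ ∫⁻ x, ‖g x * f x‖ₑ ∂AddCircle.haarAddCircle := enorm_integral_le_lintegral_enorm _
    _ ≤ ∫⁻ x, (ENNReal.ofReal (‖f x‖ * |(g x).re|) + ENNReal.ofReal (‖f x‖ * |(g x).im|))
          ∂AddCircle.haarAddCircle := by
        refine lintegral_mono fun x => ?_
        rw [← ENNReal.ofReal_add (by positivity) (by positivity), ← ofReal_norm, norm_mul,
          mul_comm, ← mul_add]
        gcongr
        exact Complex.norm_le_abs_re_add_abs_im _
    _ = ∫⁻ x, ENNReal.ofReal (‖f x‖ * |(g x).re|) ∂AddCircle.haarAddCircle +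
          ∫⁻ x, ENNReal.ofReal (‖f x‖ * |(g x).im|) ∂AddCircle.haarAddCircle := by
        refine lintegral_add_left' ?_ _
        have hgc : Continuous fun x => |(g x).re| := by fun_prop
        exact (hf.aestronglyMeasurable.norm.aemeasurable.mul
          hgc.measurable.aemeasurable).ennreal_ofReal
    _ ≤ ENNReal.ofReal K * J + ENNReal.ofReal K * J := add_le_add hre him
    _ = ENNReal.ofReal (2 * K) * J := by
        rw [ENNReal.ofReal_mul zero_le_two, ENNReal.ofReal_ofNat, two_mul, add_mul]

/-- The Fourier coefficients of `f` are controlled by its `L log^{1/2} L` integral. -/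
lemma enorm_fourierCoeff_le (f : AddCircle (1 : ℝ) → ℂ) (n : ℤ) :
    ‖fourierCoeff f n‖ₑ ≤ 2 * (1 + ∫⁻ x, (‖f x‖₊ : ℝ≥0∞) *
      ENNReal.ofReal (Real.log (1 + ‖f x‖) ^ ((1 : ℝ) / 2)) ∂AddCircle.haarAddCircle) := by
  have hpt (x : AddCircle (1 : ℝ)) : ‖fourier (-n) x • f x‖ₑ ≤ 2 + (‖f x‖₊ : ℝ≥0∞) *
      ENNReal.ofReal (Real.log (1 + ‖f x‖) ^ ((1 : ℝ) / 2)) := by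
    rw [← ofReal_norm, norm_smul, fourier_apply, Circle.norm_coe, one_mul]
    rcases le_or_gt ‖f x‖ 2 with h | h
    · refine le_add_right ?_
      rw [← ENNReal.ofReal_ofNat]
      exact ENNReal.ofReal_le_ofReal h
    · refine le_add_left ?_
      have hlog : 1 ≤ Real.log (1 + ‖f x‖) := by
        rw [Real.le_log_iff_exp_le (by linarith)]
        linarith [Real.exp_one_lt_d9]
      have hone : (1 : ℝ≥0∞) ≤ ENNReal.ofReal (Real.log (1 + ‖f x‖) ^ ((1 : ℝ) / 2)) := by
        rw [ENNReal.one_le_ofReal]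
        exact Real.one_le_rpow hlog (by norm_num)
      rw [ofReal_norm]
      exact le_mul_of_one_le_right' hone
  calc ‖fourierCoeff f n‖ₑ
      ≤ ∫⁻ x, ‖fourier (-n) x • f x‖ₑ ∂AddCircle.haarAddCircle :=
        enorm_integral_le_lintegral_enorm _
    _ ≤ _ := lintegral_mono hpt
    _ = 2 + ∫⁻ x, (‖f x‖₊ : ℝ≥0∞) *
          ENNReal.ofReal (Real.log (1 + ‖f x‖) ^ ((1 : ℝ) / 2)) ∂AddCircle.haarAddCircle := by
        rw [lintegral_add_left measurable_const, lintegral_const, measure_univ, mul_one]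
    _ ≤ _ := by
        rw [mul_add, mul_one]
        gcongr
        exact le_mul_of_one_le_left' one_le_two


/-- **Quantitative Zygmund inequality for Paley multipliers on `𝕋`.**
If `m : ℤ → ℂ` is bounded and satisfies `sup_{N ≥ 1} ∑_{N ≤ |n| ≤ 2N} |m n|² < ∞`, then there
is a constant `C > 0`, depending only on `m`, such that for every integrable `f : 𝕋 → ℂ`,
`(∑_{n ∈ ℤ} |m n * f̂ n|²)^{1/2} ≤ C (1 + ∫ |f| log^{1/2}(1+|f|))`.
The inequality is stated in `ℝ≥0∞` (so it is vacuous when the integral is infinite). -/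
theorem paley_multiplier_zygmund_inequality
    (m : ℤ → ℂ) (M : ℝ) (hM : ∀ n : ℤ, ‖m n‖ ≤ M)
    (A : ℝ)
    (hA : ∀ N : ℕ, 1 ≤ N →
      ∑ n ∈ (Finset.Icc (-(2 * (N : ℤ))) (2 * (N : ℤ))).filter (fun n => (N : ℤ) ≤ |n|),
        ‖m n‖ ^ 2 ≤ A) :
    ∃ C : ℝ, 0 < C ∧
      ∀ f : AddCircle (1 : ℝ) → ℂ, Integrable f AddCircle.haarAddCircle →
        (∑' n : ℤ, (‖m n * fourierCoeff f n‖₊ : ℝ≥0∞) ^ 2) ^ ((1 : ℝ) / 2) ≤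
          ENNReal.ofReal C *
            (1 + ∫⁻ θ, (‖f θ‖₊ : ℝ≥0∞) *
              ENNReal.ofReal (Real.log (1 + ‖f θ‖) ^ ((1 : ℝ) / 2)) ∂AddCircle.haarAddCircle) := by
  obtain ⟨K, hK0, hK⟩ := exists_sqrt_sum_le m A hA
  have hM0 : 0 ≤ M := (norm_nonneg _).trans (hM 0)
  refine ⟨2 * M + 2 * K + 1, by positivity, fun f hf => ?_⟩
  have hzero := enorm_fourierCoeff_le f 0
  have hblock := fun r S hS => hK r S hS f hf
  set J := 1 + ∫⁻ θ, (‖f θ‖₊ : ℝ≥0∞) *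
    ENNReal.ofReal (Real.log (1 + ‖f θ‖) ^ ((1 : ℝ) / 2)) ∂AddCircle.haarAddCircle
  rcases eq_or_ne J ⊤ with hJ | hJ
  · rw [hJ, ENNReal.mul_top (ENNReal.ofReal_pos.mpr (by positivity)).ne']
    exact le_top
  set j := J.toReal
  have hj0 : 0 ≤ j := ENNReal.toReal_nonneg
  have hJj : J = ENNReal.ofReal j := (ENNReal.ofReal_toReal hJ).symm
  rw [hJj] at hzero hblock ⊢
  have hzero' : ‖m 0 * fourierCoeff f 0‖ ^ 2 ≤ (2 * M * j) ^ 2 := by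
    have h : ‖fourierCoeff f 0‖ ≤ 2 * j := by
      rw [← ENNReal.ofReal_le_ofReal_iff (by positivity), ENNReal.ofReal_mul zero_le_two,
        ENNReal.ofReal_ofNat, ofReal_norm]
      exact hzero
    rw [norm_mul]
    refine pow_le_pow_left₀ (by positivity) ?_ 2
    calc ‖m 0‖ * ‖fourierCoeff f 0‖ ≤ M * (2 * j) := by gcongr; exact hM 0
      _ = 2 * M * j := by ring
  have hblock' (r : ℕ) (S : Finset ℤ)
      (hS : ∀ n ∈ S, n ≠ 0 ∧ Nat.log 2 n.natAbs % 2 = r) :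
      ∑ n ∈ S, ‖m n * fourierCoeff f n‖ ^ 2 ≤ (K * j) ^ 2 := by
    have h := hblock r S hS
    rw [← ENNReal.ofReal_mul hK0, ENNReal.ofReal_le_ofReal_iff (by positivity)] at h
    exact (Real.sqrt_le_left (by positivity)).mp h
  have hfin (S : Finset ℤ) : ∑ n ∈ S, ‖m n * fourierCoeff f n‖ ^ 2 ≤
      ((2 * M + 2 * K + 1) * j) ^ 2 := by
    rw [← Finset.sum_filter_add_sum_filter_not S (fun n => n = 0),
      ← Finset.sum_filter_add_sum_filter_not (S.filter fun n => ¬ n = 0)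
        (fun n => Nat.log 2 n.natAbs % 2 = 0)]
    have h0 : ∑ n ∈ S.filter (fun n => n = 0), ‖m n * fourierCoeff f n‖ ^ 2 ≤
        (2 * M * j) ^ 2 := by
      refine (Finset.sum_le_sum_of_subset_of_nonneg (t := {0}) (fun n hn => ?_)
        fun _ _ _ => by positivity).trans ?_
      · simpa using (Finset.mem_filter.mp hn).2
      · simpa using hzero'
    have h1 := hblock' 0 ((S.filter fun n => ¬ n = 0).filter
      fun n => Nat.log 2 n.natAbs % 2 = 0) fun n hn => by
        simp only [Finset.mem_filter] at hn
        exact ⟨hn.1.2, hn.2⟩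
    have h2 := hblock' 1 ((S.filter fun n => ¬ n = 0).filter
      fun n => ¬ Nat.log 2 n.natAbs % 2 = 0) fun n hn => by
        simp only [Finset.mem_filter] at hn
        exact ⟨hn.1.2, by omega⟩
    have hMj : 0 ≤ M * j := by positivity
    have hKj : 0 ≤ K * j := by positivity
    nlinarith [mul_nonneg hMj hKj, mul_nonneg hMj hj0, mul_nonneg hKj hj0, sq_nonneg (K * j)]
  rw [← ENNReal.ofReal_mul (by positivity), one_div, ENNReal.rpow_inv_le_iff two_pos,
    ENNReal.rpow_two, ← ENNReal.ofReal_pow (by positivity), ENNReal.tsum_eq_iSup_sum]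
  refine iSup_le fun S => ?_
  calc ∑ n ∈ S, (‖m n * fourierCoeff f n‖₊ : ℝ≥0∞) ^ 2
      = ENNReal.ofReal (∑ n ∈ S, ‖m n * fourierCoeff f n‖ ^ 2) := by
        rw [ENNReal.ofReal_sum_of_nonneg fun _ _ => by positivity]
        refine Finset.sum_congr rfl fun n _ => ?_
        rw [ENNReal.ofReal_pow (norm_nonneg _), ofReal_norm]
        rfl
    _ ≤ _ := ENNReal.ofReal_le_ofReal (hfin S)
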